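/- Continuity of the conditional distribution of random Gaussian distributions (conclusion of the worked Example establishing Assumption of distributional continuity). Let Φ : ℝ → ℝ denote the cumulative distribution function of the standard Gaussian measure gaussianReal 0 1 on ℝ, let g : ℝ → ℝ be continuous, and fix t ∈ ℝ and z ∈ (0,1). Then the map x ↦ ((gaussianReal (g x) 1)({w : Φ(t − w) ≤ z})).toReal, sending the running-variable value x to the probability that the random CDF value Φ(t − W) with W ~ N(g(x), 1) is at most z, is continuous on ℝ. -/

import Mathlib

open MeasureTheory ProbabilityTheory

/-- The Gaussian measure of a fixed set depends continuously on the mean. -/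
theorem continuous_gaussianReal_apply_toReal {v : NNReal} (hv : v ≠ 0) (s : Set ℝ) :
    Continuous (fun m : ℝ => (gaussianReal m v s).toReal) := by
  have hv' : (0 : ℝ) < v := by exact_mod_cast pos_iff_ne_zero.mpr hv
  have h_eq (m : ℝ) : (gaussianReal m v s).toReal = ∫ x in s, gaussianPDFReal m v x := by
    rw [gaussianReal_apply_eq_integral m hv,
      ENNReal.toReal_ofReal (integral_nonneg fun x => gaussianPDFReal_nonneg m v x)]
  simp_rw [h_eq]
  refine continuous_iff_continuousAt.mpr fun m₀ => ?_
  refine continuousAt_of_dominated (bound := fun x =>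
    (√(2 * Real.pi * v))⁻¹ * (Real.exp (1 / (2 * v)) *
      Real.exp (-(1 / (4 * v)) * (x - m₀) ^ 2))) ?_ ?_ ?_ ?_
  · exact .of_forall fun m => (stronglyMeasurable_gaussianPDFReal m v).aestronglyMeasurable
  · filter_upwards [Metric.ball_mem_nhds m₀ one_pos] with m hm
    refine .of_forall fun x => ?_
    rw [Real.norm_of_nonneg (gaussianPDFReal_nonneg m v x), gaussianPDFReal, ← Real.exp_add]
    gcongr
    rw [Metric.mem_ball, Real.dist_eq, abs_lt] at hm
    have h_sq : (x - m₀) ^ 2 ≤ 2 * (x - m) ^ 2 + 2 := by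
      nlinarith [sq_nonneg ((x - m) - (m - m₀))]
    have h_split : 1 / (2 * (v : ℝ)) + -(1 / (4 * v)) * (x - m₀) ^ 2 - -(x - m) ^ 2 / (2 * v)
        = (2 * (x - m) ^ 2 + 2 - (x - m₀) ^ 2) / (4 * v) := by
      field_simp
      ring
    refine sub_nonneg.mp (h_split ▸ div_nonneg (by linarith) (by positivity))
  · exact ((((integrable_exp_neg_mul_sq (by positivity)).comp_sub_right m₀).const_mul
      _).const_mul _).integrableOn
  · refine .of_forall fun x => Continuous.continuousAt ?_
    unfold gaussianPDFReal
    fun_prop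

/-- Continuity of the conditional distribution of random Gaussian distributions:
for `Φ` the standard normal CDF, `g` continuous, `t ∈ ℝ`, and `z ∈ (0,1)`, the
map `x ↦ ℙ(Φ(t − W) ≤ z)` with `W ~ N(g(x), 1)` is continuous in `x`. -/
theorem gaussian_conditional_distribution_continuous
    (Φ : ℝ → ℝ)
    (hΦ : ∀ x : ℝ, Φ x = ((gaussianReal 0 1) (Set.Iic x)).toReal)
    (g : ℝ → ℝ) (hg : Continuous g)
    (t z : ℝ) (hz : z ∈ Set.Ioo (0 : ℝ) 1) :
    Continuous (fun x : ℝ =>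
      ((gaussianReal (g x) 1) {w : ℝ | Φ (t - w) ≤ z}).toReal) := by
  exact (continuous_gaussianReal_apply_toReal one_ne_zero _).comp hg
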